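/- Let p be a prime, R a commutative ring of characteristic p, and R[𝔛] the graded polynomial ring in variables x_1,…,x_m with deg x_i = p^{d_i}. Let I ⊆ R[𝔛] be a twisted-linear ideal such that R[𝔛]/I is flat as an R-module. Then for every R-algebra S and every N ∈ ℕ, the S-submodule of S[𝔛] spanned by the image of FPV_N(R) ∩ I under the base-change map R[𝔛] → S[𝔛] equals FPV_N(S) ∩ (I·S[𝔛]), where I·S[𝔛] denotes the extension of I to S[𝔛]. -/

import Mathlib

open MvPolynomial

/-- `FPV p R mv d l` is the `R`-submodule of the polynomial ring `R[x_1,…,x_mv]`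
(graded by `deg x_i = p^{d i}`) spanned by the twisted-linear monomials
`x_i ^ p^(l - d i)` for those `i` with `d i ≤ l`. -/
noncomputable def FPV (p : ℕ) (R : Type*) [CommRing R] (mv : ℕ) (d : Fin mv → ℕ) (l : ℕ) :
    Submodule R (MvPolynomial (Fin mv) R) :=
  Submodule.span R {f | ∃ i : Fin mv, d i ≤ l ∧ f = X i ^ p ^ (l - d i)}

section
variable {mv : ℕ} {R : Type*} [CommRing R]

noncomputable def sig (T : Fin mv → ℕ → MvPolynomial (Fin mv) R) :
    MvPolynomial (Fin mv) R →ₗ[R] MvPolynomial (Fin mv) R :=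
  (MvPolynomial.basisMonomials (Fin mv) R).constr R (fun α => ∏ i, T i (α i))

lemma sig_monomial (T : Fin mv → ℕ → MvPolynomial (Fin mv) R) (α : Fin mv →₀ ℕ) (a : R) :
    sig T (monomial α a) = a • ∏ i, T i (α i) := by
  have h : monomial α a = a • MvPolynomial.basisMonomials (Fin mv) R α := by
    simp [MvPolynomial.smul_monomial]
  rw [h, map_smul, sig, Module.Basis.constr_basis]

lemma sig_shift (T : Fin mv → ℕ → MvPolynomial (Fin mv) R) (j : Fin mv) (k : ℕ)
    (c : MvPolynomial (Fin mv) R) (hc : ∀ n, T j (n + k) = c * T j n)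
    (h : MvPolynomial (Fin mv) R) : sig T (X j ^ k * h) = c * sig T h := by
  induction h using MvPolynomial.induction_on' with
  | monomial u a =>
    rw [X_pow_eq_monomial, monomial_mul, one_mul, sig_monomial, sig_monomial, mul_smul_comm]
    congr 1
    rw [← Finset.mul_prod_erase _ _ (Finset.mem_univ j),
      ← Finset.mul_prod_erase _ (fun i => T i (u i)) (Finset.mem_univ j), ← mul_assoc, ← hc]
    congr 1
    · simp [add_comm]
    · refine Finset.prod_congr rfl fun i hi => ?_
      have : j ≠ i := (Finset.ne_of_mem_erase hi).symm
      simp [this]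
  | add p q hp hq => rw [mul_add, map_add, map_add, hp, hq, mul_add]

lemma sig_one (T : Fin mv → ℕ → MvPolynomial (Fin mv) R) (h0 : ∀ i, T i 0 = 1) :
    sig T 1 = 1 := by
  rw [← C_1, ← monomial_zero', sig_monomial]; simp [h0]

lemma sig_homog (T : Fin mv → ℕ → MvPolynomial (Fin mv) R) (w : Fin mv → ℕ)
    (hT : ∀ i n, IsWeightedHomogeneous w (T i n) (n * w i)) (h : MvPolynomial (Fin mv) R) (n : ℕ)
    (hh : IsWeightedHomogeneous w h n) : IsWeightedHomogeneous w (sig T h) n := by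
  rw [h.as_sum, map_sum]
  refine IsWeightedHomogeneous.sum _ _ _ fun α hα => ?_
  rw [sig_monomial]
  have h1 := IsWeightedHomogeneous.prod Finset.univ (fun i => T i (α i)) _ (fun i _ => hT i (α i))
  have h2 : ∑ i, α i * w i = n := by
    rw [← hh (mem_support_iff.mp hα), Finsupp.weight_apply, Finsupp.sum_fintype] <;> simp
  rw [h2] at h1
  exact (weightedHomogeneousSubmodule R w n).smul_mem _ h1

lemma sig_lin (T : Fin mv → ℕ → MvPolynomial (Fin mv) R) (E : Set (Fin mv))
    (hE : ∀ i ∈ E, ∀ n, T i n = X i ^ n) (u : MvPolynomial (Fin mv) R)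
    (hu : u ∈ Algebra.adjoin R (X '' E : Set (MvPolynomial (Fin mv) R))) :
    ∀ h, sig T (u * h) = u * sig T h := by
  induction hu using Algebra.adjoin_induction with
  | mem x hx =>
    obtain ⟨i, hi, rfl⟩ := hx
    intro h
    have := sig_shift T i 1 (X i) (fun n => by rw [hE i hi, hE i hi, pow_succ']) h
    rwa [pow_one] at this
  | algebraMap r => intro h; rw [← Algebra.smul_def, ← Algebra.smul_def, map_smul]
  | add x y _ _ hx hy => intro h; rw [add_mul, map_add, hx, hy, add_mul]
  | mul x y _ _ hx hy => intro h; rw [mul_assoc, hx, hy, mul_assoc]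

end

section
variable (p : ℕ) (R : Type*) [CommRing R] (mv : ℕ) (d : Fin mv → ℕ)

noncomputable def FE (E : Set (Fin mv)) (l : ℕ) : Submodule R (MvPolynomial (Fin mv) R) :=
  Submodule.span R {f | ∃ i ∈ E, d i ≤ l ∧ f = X i ^ p ^ (l - d i)}

lemma FE_le_FPV (E : Set (Fin mv)) (l : ℕ) : FE p R mv d E l ≤ FPV p R mv d l :=
  Submodule.span_mono (by rintro _ ⟨i, _, h⟩; exact ⟨i, h⟩)

lemma FE_le_adjoin (E : Set (Fin mv)) (l : ℕ) : FE p R mv d E l ≤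
    Subalgebra.toSubmodule (Algebra.adjoin R (X '' E : Set (MvPolynomial (Fin mv) R))) := by
  refine Submodule.span_le.mpr ?_
  rintro _ ⟨i, hi, _, rfl⟩
  exact Subalgebra.pow_mem _ (Algebra.subset_adjoin (Set.mem_image_of_mem X hi)) _

lemma FPV_homog (l : ℕ) : FPV p R mv d l ≤ weightedHomogeneousSubmodule R (fun i => p ^ d i) (p ^ l) := by
  refine Submodule.span_le.mpr ?_
  rintro _ ⟨i, hi, rfl⟩
  have := (isWeightedHomogeneous_X R (fun i => p ^ d i) i).pow (p ^ (l - d i))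
  rw [smul_eq_mul, ← pow_add, Nat.sub_add_cancel hi] at this
  exact this

noncomputable def piN (N : ℕ) : MvPolynomial (Fin mv) R →ₗ[R] MvPolynomial (Fin mv) R :=
  ∑ i, if d i ≤ N then
    (lcoeff R (Finsupp.single i (p ^ (N - d i)))).smulRight (X i ^ p ^ (N - d i)) else 0

lemma piN_apply (N : ℕ) (f : MvPolynomial (Fin mv) R) : piN p R mv d N f =
    ∑ i, if d i ≤ N then coeff (Finsupp.single i (p ^ (N - d i))) f • (X i ^ p ^ (N - d i) : MvPolynomial (Fin mv) R) else 0 := by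
  rw [piN, LinearMap.sum_apply]
  refine Finset.sum_congr rfl fun i _ => ?_
  split_ifs <;> simp

lemma piN_mem (N : ℕ) (f : MvPolynomial (Fin mv) R) : piN p R mv d N f ∈ FPV p R mv d N := by
  rw [piN_apply]
  refine Submodule.sum_mem _ fun i _ => ?_
  split_ifs with h
  · exact Submodule.smul_mem _ _ (Submodule.subset_span ⟨i, h, rfl⟩)
  · exact zero_mem _

lemma piN_id (hp : p.Prime) (N : ℕ) (f : MvPolynomial (Fin mv) R) (hf : f ∈ FPV p R mv d N) :
    piN p R mv d N f = f := by
  induction hf using Submodule.span_induction with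
  | mem x hx =>
    obtain ⟨j, hj, rfl⟩ := hx
    rw [piN_apply, Finset.sum_eq_single j]
    · rw [if_pos hj, coeff_X_pow, if_pos rfl, one_smul]
    · intro i _ hij
      split_ifs with h
      · rw [coeff_X_pow, if_neg, zero_smul]
        rw [Finsupp.single_eq_single_iff]
        have := pow_pos hp.pos (N - d j)
        rintro (h | h)
        · exact hij h.1.symm
        · omega
      · rfl
    · simp
  | zero => simp
  | add x y _ _ hx hy => rw [map_add, hx, hy]
  | smul a x _ hx => rw [map_smul, hx]

lemma piN_zero (N n : ℕ) (hn : n ≠ p ^ N) (f : MvPolynomial (Fin mv) R)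
    (hf : IsWeightedHomogeneous (fun i => p ^ d i) f n) : piN p R mv d N f = 0 := by
  rw [piN_apply]
  refine Finset.sum_eq_zero fun i _ => ?_
  split_ifs with h
  · rw [hf.coeff_eq_zero, zero_smul]
    rw [Finsupp.weight_single, smul_eq_mul, ← pow_add, Nat.sub_add_cancel h]
    exact hn.symm
  · rfl

variable {R mv}
structure St (W : ℕ → Submodule R (MvPolynomial (Fin mv) R)) (N : ℕ) (E : Set (Fin mv))
    (ρ : MvPolynomial (Fin mv) R →ₗ[R] MvPolynomial (Fin mv) R) : Prop where
  kill : ∀ l < N, ∀ w ∈ W l, ∀ h, ρ (h * w) = 0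
  lin : ∀ u ∈ Algebra.adjoin R (X '' E : Set (MvPolynomial (Fin mv) R)), ∀ h, ρ (u * h) = u * ρ h
  one : ρ 1 = 1
  homog : ∀ n h, IsWeightedHomogeneous (fun i => p ^ d i) h n →
    IsWeightedHomogeneous (fun i => p ^ d i) (ρ h) n
  red : ∀ x ∈ FPV p R mv d N, ∃ x0 ∈ FE p R mv d E N, x - x0 ∈ W N ∧ ∀ h, ρ (h * (x - x0)) = 0
  big : ∀ i, N ≤ d i → i ∈ E

variable {p d} {W : ℕ → Submodule R (MvPolynomial (Fin mv) R)} {N : ℕ} {E : Set (Fin mv)}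
    {ρ : MvPolynomial (Fin mv) R →ₗ[R] MvPolynomial (Fin mv) R}

lemma St.fix (h : St p d W N E ρ) {u : MvPolynomial (Fin mv) R} (hu : u ∈ FE p R mv d E N) :
    ρ u = u := by
  have := h.lin u (FE_le_adjoin p R mv d E N hu) 1
  rwa [h.one, mul_one] at this

lemma St.ret (hp : p.Prime) (h : St p d W N E ρ) {x : MvPolynomial (Fin mv) R}
    (hx : x ∈ FPV p R mv d N) : piN p R mv d N (ρ x) - x ∈ W N := by
  obtain ⟨x0, h0, h1, h2⟩ := h.red x hx
  have h3 := h2 1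
  rw [one_mul, map_sub, sub_eq_zero, h.fix h0] at h3
  rw [h3, piN_id p R mv d hp N _ (FE_le_FPV p R mv d E N h0), ← neg_sub]
  exact neg_mem h1

lemma St.killI (hp : p.Prime) (hW1 : ∀ l, W l ≤ FPV p R mv d l) (h : St p d W N E ρ)
    (y : MvPolynomial (Fin mv) R)
    (hy : y ∈ Ideal.span (⋃ l, (W l : Set (MvPolynomial (Fin mv) R)))) :
    piN p R mv d N (ρ y) ∈ W N := by
  suffices ∀ k, piN p R mv d N (ρ (k * y)) ∈ W N by simpa using this 1
  induction hy using Submodule.span_induction with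
  | zero => simp
  | add x y _ _ hx hy => 
    intro k; rw [mul_add, map_add, map_add]; exact add_mem (hx k) (hy k)
  | smul a x _ hx => intro k; rw [smul_eq_mul, ← mul_assoc]; exact hx _
  | mem w hw =>
    obtain ⟨l, hw⟩ := Set.mem_iUnion.mp hw
    intro k
    by_cases hl : l < N
    · rw [h.kill l hl w hw, map_zero]; exact zero_mem _
    induction k using MvPolynomial.induction_on' with
    | add a b ha hb => rw [add_mul, map_add, map_add]; exact add_mem ha hb
    | monomial u a =>
      have h1 := (isWeightedHomogeneous_monomial (fun i => p ^ d i) u a rfl).mul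
        (FPV_homog p R mv d l (hW1 l hw))
      by_cases h2 : Finsupp.weight (fun i => p ^ d i) u + p ^ l = p ^ N
      · have h3 : p ^ N ≤ p ^ l := Nat.pow_le_pow_right hp.pos (not_lt.mp hl)
        have h4 : Finsupp.weight (fun i => p ^ d i) u = 0 := by omega
        have h5 : l = N := Nat.pow_right_injective hp.two_le (by dsimp only; omega)
        have h6 : u = 0 := by
          ext i
          rw [Finsupp.weight_apply, Finsupp.sum_fintype _ _ (by simp), Finset.sum_eq_zero_iff] at h4
          have := h4 i (Finset.mem_univ i)
          rw [smul_eq_mul, mul_eq_zero] at this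
          exact this.resolve_right (pow_pos hp.pos _).ne'
        subst h5 h6
        rw [monomial_zero', ← smul_eq_C_mul, map_smul, map_smul]
        refine Submodule.smul_mem _ _ ?_
        have := add_mem (h.ret hp (hW1 l hw)) hw
        rwa [sub_add_cancel] at this
      · rw [piN_zero p R mv d N _ h2 _ (h.homog _ _ h1)]; exact zero_mem _

lemma St.flat (hp : p.Prime) (hW1 : ∀ l, W l ≤ FPV p R mv d l) (h : St p d W N E ρ)
    (I : Ideal (MvPolynomial (Fin mv) R))
    (hI : I = Ideal.span (⋃ l, (W l : Set (MvPolynomial (Fin mv) R))))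
    (hflat : Module.Flat R (MvPolynomial (Fin mv) R ⧸ I)) :
    Module.Flat R (FPV p R mv d N ⧸ (W N).comap (FPV p R mv d N).subtype) := by
  let i0 : FPV p R mv d N →ₗ[R] MvPolynomial (Fin mv) R ⧸ I :=
    (Ideal.Quotient.mkₐ R I).toLinearMap ∘ₗ (FPV p R mv d N).subtype
  let i : (FPV p R mv d N ⧸ (W N).comap (FPV p R mv d N).subtype) →ₗ[R]
      MvPolynomial (Fin mv) R ⧸ I := Submodule.liftQ _ i0 (by
    intro x hx
    rw [LinearMap.mem_ker]
    change Ideal.Quotient.mk I (x : MvPolynomial (Fin mv) R) = 0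
    rw [Ideal.Quotient.eq_zero_iff_mem, hI]
    exact Ideal.subset_span (Set.mem_iUnion.mpr ⟨N, hx⟩))
  let r0 : MvPolynomial (Fin mv) R →ₗ[R] (FPV p R mv d N ⧸ (W N).comap (FPV p R mv d N).subtype) :=
    Submodule.mkQ _ ∘ₗ (LinearMap.codRestrict (FPV p R mv d N) (piN p R mv d N ∘ₗ ρ)
      (fun c => piN_mem p R mv d N _))
  let r1 : (MvPolynomial (Fin mv) R ⧸ I.restrictScalars R) →ₗ[R]
      (FPV p R mv d N ⧸ (W N).comap (FPV p R mv d N).subtype) := Submodule.liftQ _ r0 (by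
    intro x hx
    rw [LinearMap.mem_ker]
    simp only [r0, LinearMap.comp_apply, Submodule.mkQ_apply]
    rw [Submodule.Quotient.mk_eq_zero]
    exact h.killI hp hW1 x (hI ▸ hx))
  refine Module.Flat.of_retract i (r1 ∘ₗ (Submodule.Quotient.restrictScalarsEquiv R I).symm.toLinearMap) ?_
  refine Submodule.linearMap_qext _ (LinearMap.ext fun x => ?_)
  change Submodule.Quotient.mk _ = Submodule.Quotient.mk _
  rw [Submodule.Quotient.eq]
  exact h.ret hp x.2

end

section
variable {p : ℕ} {R : Type*} [CommRing R] {mv : ℕ} {d : Fin mv → ℕ}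
variable {W : ℕ → Submodule R (MvPolynomial (Fin mv) R)} {N : ℕ} {E : Set (Fin mv)}
    {ρ : MvPolynomial (Fin mv) R →ₗ[R] MvPolynomial (Fin mv) R}

lemma FE_pow [Fact p.Prime] [CharP R p] {x : MvPolynomial (Fin mv) R}
    (hx : x ∈ FE p R mv d E N) : x ^ p ∈ FE p R mv d E (N + 1) := by
  induction hx using Submodule.span_induction with
  | zero => rw [zero_pow (Fact.out : p.Prime).ne_zero]; exact zero_mem _
  | add x y _ _ hx hy => rw [add_pow_char]; exact add_mem hx hy
  | smul a x _ hx => rw [smul_pow]; exact Submodule.smul_mem _ _ hx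
  | mem x hx =>
    obtain ⟨i, hi, hd, rfl⟩ := hx
    refine Submodule.subset_span ⟨i, hi, by omega, ?_⟩
    rw [← pow_mul, ← pow_succ]
    congr 2; omega

lemma FPV_finite (N : ℕ) : Module.Finite R (FPV p R mv d N) := by
  refine Module.Finite.span_of_finite R ?_
  refine (Set.finite_range (fun i : Fin mv => (X i ^ p ^ (N - d i) : MvPolynomial (Fin mv) R))).subset ?_
  rintro _ ⟨i, _, rfl⟩
  exact ⟨i, rfl⟩

/-- choice of the next live set -/
lemma St.choose [IsLocalRing R] (h : St p d W N E ρ)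
    (hfl : Module.Flat R (FPV p R mv d N ⧸ (W N).comap (FPV p R mv d N).subtype)) :
    ∃ E' ⊆ E, (∀ i, N + 1 ≤ d i → i ∈ E') ∧
      (∀ x ∈ FPV p R mv d N, ∃ x0 ∈ FE p R mv d E' N, x - x0 ∈ W N) ∧
      (∀ x ∈ FE p R mv d E' N, x ∈ W N → x = 0) := by
  have := FPV_finite (p := p) (R := R) (d := d) N
  have hfree : Module.Free R (FPV p R mv d N ⧸ (W N).comap (FPV p R mv d N).subtype) :=
    Module.free_of_flat_of_isLocalRing
  have hfp := Module.finitePresentation_of_projective R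
    (FPV p R mv d N ⧸ (W N).comap (FPV p R mv d N).subtype)
  let mk := ((W N).comap (FPV p R mv d N).subtype).mkQ
  let v0 : {i // i ∈ E ∧ d i ≤ N} → FPV p R mv d N := fun i =>
    ⟨X i.1 ^ p ^ (N - d i.1), Submodule.subset_span ⟨i.1, i.2.2, rfl⟩⟩
  have hspan : Submodule.span R (Set.range (fun i => mk (v0 i))) = ⊤ := by
    rw [eq_top_iff]
    rintro q -
    obtain ⟨x, rfl⟩ := Submodule.mkQ_surjective _ q
    obtain ⟨x0, h0, h1, -⟩ := h.red x.1 x.2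
    have e : mk x = mk ⟨x0, FE_le_FPV p R mv d E N h0⟩ := by
      refine (Submodule.Quotient.eq _).mpr ?_
      exact h1
    change mk x ∈ _
    rw [e]
    clear e h1 x
    induction h0 using Submodule.span_induction with
    | mem x hx =>
      obtain ⟨i, hi, hd, rfl⟩ := hx
      exact Submodule.subset_span ⟨⟨i, hi, hd⟩, rfl⟩
    | zero => exact zero_mem _
    | add x y _ _ hx hy => exact add_mem hx hy
    | smul a x _ hx => exact Submodule.smul_mem _ a hx
  obtain ⟨κ, a, b, hb⟩ := Module.exists_basis_of_span_of_flat _ hspan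
  refine ⟨Set.range (fun k => (a k).1) ∪ {i | N + 1 ≤ d i}, ?_, fun i hi => Or.inr hi, ?_, ?_⟩
  · rintro i (⟨k, rfl⟩ | hi)
    · exact (a k).2.1
    · exact h.big i (by have : N + 1 ≤ d i := hi; omega)
  · intro x hx
    have hq : mk ⟨x, hx⟩ ∈ Submodule.span R (Set.range b) := by rw [b.span_eq]; trivial
    rw [Finsupp.mem_span_range_iff_exists_finsupp] at hq
    obtain ⟨c, hc⟩ := hq
    refine ⟨((c.sum fun k r => r • v0 (a k) : FPV p R mv d N) : MvPolynomial (Fin mv) R), ?_, ?_⟩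
    · rw [Finsupp.sum, Submodule.coe_sum]
      refine Submodule.sum_mem _ fun k _ => Submodule.smul_mem _ _ ?_
      exact Submodule.subset_span ⟨(a k).1, Or.inl ⟨k, rfl⟩, (a k).2.2, rfl⟩
    · have e : mk ⟨x, hx⟩ = mk (c.sum fun k r => r • v0 (a k)) := by
        rw [← hc, Finsupp.sum, Finsupp.sum, map_sum]
        refine Finset.sum_congr rfl fun k _ => ?_
        rw [hb, map_smul]
      exact (Submodule.Quotient.eq ((W N).comap (FPV p R mv d N).subtype)).mp e
  · intro x hx hxW
    have hle : FE p R mv d (Set.range (fun k => (a k).1) ∪ {i | N + 1 ≤ d i}) N ≤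
        Submodule.span R (Set.range (fun k => (v0 (a k) : MvPolynomial (Fin mv) R))) := by
      refine Submodule.span_mono ?_
      rintro _ ⟨i, (⟨k, rfl⟩ | hi), hd, rfl⟩
      · exact ⟨k, rfl⟩
      · have : N + 1 ≤ d i := hi
        omega
    obtain ⟨c, rfl⟩ := Finsupp.mem_span_range_iff_exists_finsupp.mp (hle hx)
    have e : mk (c.sum fun k r => r • v0 (a k)) = 0 := by
      refine (Submodule.Quotient.mk_eq_zero _).mpr ?_
      change ((c.sum fun k r => r • v0 (a k) : FPV p R mv d N) : MvPolynomial (Fin mv) R) ∈ W N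
      rw [Finsupp.sum, Submodule.coe_sum]
      exact hxW
    have e2 : Finsupp.linearCombination R b c = 0 := by
      rw [← e, Finsupp.linearCombination_apply, Finsupp.sum, Finsupp.sum, map_sum]
      refine Finset.sum_congr rfl fun k _ => ?_
      rw [hb, map_smul]
    have e3 : c = 0 := (linearIndependent_iff.mp b.linearIndependent) c e2
    simp [e3]

lemma St.step [IsLocalRing R] [Fact p.Prime] [CharP R p] (hW1 : ∀ l, W l ≤ FPV p R mv d l)
    (hW2 : ∀ l, ∀ w ∈ W l, w ^ p ∈ W (l + 1)) (h : St p d W N E ρ)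
    (hfl : Module.Flat R (FPV p R mv d N ⧸ (W N).comap (FPV p R mv d N).subtype)) :
    ∃ E' ρ', St p d W (N + 1) E' ρ' := by
  classical
  have hp : p.Prime := Fact.out
  obtain ⟨E', hE', hbig, hred, hind⟩ := h.choose hfl
  have hL : ∀ j, ∃ L ∈ FE p R mv d E' N, d j ≤ N → X j ^ p ^ (N - d j) - L ∈ W N := by
    intro j
    by_cases hj : d j ≤ N
    · obtain ⟨L, h1, h2⟩ := hred (X j ^ p ^ (N - d j)) (Submodule.subset_span ⟨j, hj, rfl⟩)
      exact ⟨L, h1, fun _ => h2⟩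
    · exact ⟨0, zero_mem _, fun h => absurd h hj⟩
  choose L hL1 hL2 using hL
  let T : Fin mv → ℕ → MvPolynomial (Fin mv) R := fun i n =>
    if i ∈ E' then X i ^ n else L i ^ (n / p ^ (N - d i)) * X i ^ (n % p ^ (N - d i))
  have hT1 : ∀ i ∈ E', ∀ n, T i n = X i ^ n := fun i hi n => if_pos hi
  have hd : ∀ i ∉ E', d i ≤ N := fun i hi => by
    by_contra hc; exact hi (hbig i (by omega))
  have hslin := sig_lin T E' hT1
  have hs1 : sig T 1 = 1 := sig_one T fun i => by
    by_cases hi : i ∈ E' <;> simp [T, hi]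
  have hshom := sig_homog T (fun i => p ^ d i) (fun i n => by
    by_cases hi : i ∈ E'
    · rw [hT1 i hi]
      have := (isWeightedHomogeneous_X R (fun i => p ^ d i) i).pow n
      rwa [smul_eq_mul] at this
    · simp only [T, if_neg hi]
      have h1 := (FPV_homog p R mv d N (FE_le_FPV p R mv d E' N (hL1 i)))
      rw [mem_weightedHomogeneousSubmodule] at h1
      have h2 := (h1.pow (n / p ^ (N - d i))).mul
        ((isWeightedHomogeneous_X R (fun i => p ^ d i) i).pow (n % p ^ (N - d i)))
      convert h2 using 1
      have e : p ^ N = p ^ (N - d i) * p ^ d i := by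
        rw [← pow_add, Nat.sub_add_cancel (hd i hi)]
      rw [smul_eq_mul, smul_eq_mul, e, ← mul_assoc, ← add_mul, Nat.div_add_mod'])
  have hskill : ∀ j ∉ E', ∀ k, sig T ((X j ^ p ^ (N - d j) - L j) * k) = 0 := by
    intro j hj k
    rw [sub_mul, map_sub, sig_shift T j _ (L j) _ k,
      hslin _ (FE_le_adjoin p R mv d E' N (hL1 j)), sub_self]
    intro n
    have hpos := pow_pos hp.pos (N - d j)
    simp only [T, if_neg hj]
    rw [Nat.add_div_right _ hpos, Nat.add_mod_right, pow_succ']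
    ring
  have hg : ∀ w0 ∈ FE p R mv d E N, ∃ g ∈ W N, (∀ k, sig T (g * k) = 0) ∧
      w0 - g ∈ FE p R mv d E' N := by
    intro w0 hw0
    induction hw0 using Submodule.span_induction with
    | zero => exact ⟨0, zero_mem _, by simp, by simp⟩
    | add x y _ _ hx hy =>
      obtain ⟨g, h1, h2, h3⟩ := hx
      obtain ⟨g', h1', h2', h3'⟩ := hy
      refine ⟨g + g', add_mem h1 h1', fun k => ?_, ?_⟩
      · rw [add_mul, map_add, h2, h2', add_zero]
      · rw [add_sub_add_comm]; exact add_mem h3 h3'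
    | smul a x _ hx =>
      obtain ⟨g, h1, h2, h3⟩ := hx
      refine ⟨a • g, Submodule.smul_mem _ _ h1, fun k => ?_, ?_⟩
      · rw [smul_mul_assoc, map_smul, h2, smul_zero]
      · rw [← smul_sub]; exact Submodule.smul_mem _ _ h3
    | mem x hx =>
      obtain ⟨i, hi, hdi, rfl⟩ := hx
      by_cases hi' : i ∈ E'
      · exact ⟨0, zero_mem _, by simp, by rw [sub_zero]; exact Submodule.subset_span ⟨i, hi', hdi, rfl⟩⟩
      · exact ⟨_, hL2 i hdi, hskill i hi', by rw [sub_sub_cancel]; exact hL1 i⟩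
  have hkill : ∀ l < N + 1, ∀ w ∈ W l, ∀ k, (sig T ∘ₗ ρ) (k * w) = 0 := by
    intro l hl w hw k
    rw [LinearMap.comp_apply]
    rcases Nat.lt_succ_iff_lt_or_eq.mp hl with hl | rfl
    · rw [h.kill l hl w hw, map_zero]
    · obtain ⟨w0, h0, h1, h2⟩ := h.red w (hW1 _ hw)
      have h3 : ρ (k * w) = w0 * ρ k := by
        have := h2 k
        rw [mul_sub, map_sub, sub_eq_zero] at this
        rw [this, mul_comm, h.lin w0 (FE_le_adjoin p R mv d E l h0)]
      obtain ⟨g, g1, g2, g3⟩ := hg w0 h0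
      have h4 : w0 ∈ W l := by
        have := sub_mem hw h1
        rwa [sub_sub_cancel] at this
      have h5 := hind _ g3 (sub_mem h4 g1)
      rw [sub_eq_zero] at h5
      rw [h3, h5, g2]
  refine ⟨E', sig T ∘ₗ ρ, hkill, ?_, ?_, ?_, ?_, hbig⟩
  · intro u hu k
    rw [LinearMap.comp_apply, h.lin u (Algebra.adjoin_mono (Set.image_mono hE') hu),
      hslin u hu, LinearMap.comp_apply]
  · rw [LinearMap.comp_apply, h.one, hs1]
  · intro n k hk
    exact hshom _ _ (h.homog _ _ hk)
  · intro x hx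
    induction hx using Submodule.span_induction with
    | zero => exact ⟨0, zero_mem _, by simp, by simp⟩
    | add x y _ _ hx hy =>
      obtain ⟨g, h1, h2, h3⟩ := hx
      obtain ⟨g', h1', h2', h3'⟩ := hy
      refine ⟨g + g', add_mem h1 h1', ?_, fun k => ?_⟩
      · rw [add_sub_add_comm]; exact add_mem h2 h2'
      · rw [add_sub_add_comm, mul_add, map_add, h3, h3', add_zero]
    | smul a x _ hx =>
      obtain ⟨g, h1, h2, h3⟩ := hx
      refine ⟨a • g, Submodule.smul_mem _ _ h1, ?_, fun k => ?_⟩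
      · rw [← smul_sub]; exact Submodule.smul_mem _ _ h2
      · rw [← smul_sub, mul_smul_comm, map_smul, h3, smul_zero]
    | mem x hx =>
      obtain ⟨i, hdi, rfl⟩ := hx
      by_cases hi' : i ∈ E'
      · exact ⟨_, Submodule.subset_span ⟨i, hi', hdi, rfl⟩, by simp, by simp⟩
      · have hdi' := hd i hi'
        have e : (X i ^ p ^ (N + 1 - d i) - L i ^ p : MvPolynomial (Fin mv) R) =
            (X i ^ p ^ (N - d i) - L i) ^ p := by
          rw [sub_pow_char, ← pow_mul, ← pow_succ]
          congr 3; omega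
        refine ⟨L i ^ p, FE_pow (hL1 i), ?_, fun k => ?_⟩
        · rw [e]; exact hW2 _ _ (hL2 i hdi')
        · rw [e, ← pow_sub_one_mul hp.ne_zero, ← mul_assoc]
          exact hkill N (by omega) _ (hL2 i hdi') _

theorem local_main [IsLocalRing R] [Fact p.Prime] [CharP R p]
    (hW1 : ∀ l, W l ≤ FPV p R mv d l)
    (hW2 : ∀ l, ∀ w ∈ W l, w ^ p ∈ W (l + 1))
    (I : Ideal (MvPolynomial (Fin mv) R))
    (hI : I = Ideal.span (⋃ l, (W l : Set (MvPolynomial (Fin mv) R))))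
    (hflat : Module.Flat R (MvPolynomial (Fin mv) R ⧸ I)) (N : ℕ)
    (f : MvPolynomial (Fin mv) R) (hf : f ∈ FPV p R mv d N) (hfI : f ∈ I) : f ∈ W N := by
  have hp : p.Prime := Fact.out
  have key : ∀ N, ∃ E ρ, St p d W N E ρ := by
    intro N
    induction N with
    | zero =>
      refine ⟨Set.univ, LinearMap.id, ?_, ?_, ?_, ?_, ?_, ?_⟩
      · intro l hl; omega
      · intros; rfl
      · rfl
      · intro n k hk; exact hk
      · intro x hx
        refine ⟨x, ?_, by simp, by simp⟩
        refine Submodule.span_mono ?_ hx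
        rintro _ ⟨i, hi⟩
        exact ⟨i, trivial, hi⟩
      · intros; trivial
    | succ N ih =>
      obtain ⟨E, ρ, h⟩ := ih
      exact h.step hW1 hW2 (h.flat hp hW1 I hI hflat)
  obtain ⟨E, ρ, h⟩ := key N
  have := sub_mem (h.killI hp hW1 f (hI ▸ hfI)) (h.ret hp hf)
  rwa [sub_sub_cancel] at this

end

section
attribute [local instance] MvPolynomial.algebraMvPolynomial

lemma flat_baseChange {R S : Type*} [CommRing R] [CommRing S] [Algebra R S] {mv : ℕ}
    (I : Ideal (MvPolynomial (Fin mv) R)) (hflat : Module.Flat R (MvPolynomial (Fin mv) R ⧸ I)) :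
    Module.Flat S (MvPolynomial (Fin mv) S ⧸ I.map (MvPolynomial.map (algebraMap R S))) := by
  have e1 := (Algebra.TensorProduct.quotIdealMapEquivTensorQuot (MvPolynomial (Fin mv) S) I).toLinearEquiv.restrictScalars S
  have e2 := Algebra.IsPushout.cancelBaseChange R S (MvPolynomial (Fin mv) R) (MvPolynomial (Fin mv) S)
    (MvPolynomial (Fin mv) R ⧸ I)
  exact Module.Flat.of_linearEquiv (e1.trans e2)

lemma isLocMod {S T : Type*} [CommRing S] [CommRing T] [Algebra S T] (M : Submonoid S)
    [IsLocalization M T] (mv : ℕ) : IsLocalizedModule M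
      (MvPolynomial.mapAlgHom (σ := Fin mv) (Algebra.ofId S T)).toLinearMap := by
  have h := MvPolynomial.isLocalization (σ := Fin mv) M T
  have := (isLocalizedModule_iff_isLocalization (S := M) (A := MvPolynomial (Fin mv) S)
    (Aₛ := MvPolynomial (Fin mv) T)).mpr h
  convert this using 1
  exact LinearMap.ext fun x => by simp
end

section
variable {p : ℕ} {R : Type*} [CommRing R] {mv : ℕ} {d : Fin mv → ℕ}

lemma FPV_map {S : Type*} [CommRing S] (φ : R →+* S) {N : ℕ} {x : MvPolynomial (Fin mv) R}
    (hx : x ∈ FPV p R mv d N) : MvPolynomial.map φ x ∈ FPV p S mv d N := by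
  induction hx using Submodule.span_induction with
  | zero => rw [map_zero]; exact zero_mem _
  | add x y _ _ hx hy => rw [map_add]; exact add_mem hx hy
  | smul a x _ hx => rw [smul_eq_C_mul, map_mul, map_C, ← smul_eq_C_mul]; exact Submodule.smul_mem _ _ hx
  | mem x hx =>
    obtain ⟨i, hd, rfl⟩ := hx
    exact Submodule.subset_span ⟨i, hd, by rw [map_pow, map_X]⟩

lemma FPV_pow [Fact p.Prime] [CharP R p] {N : ℕ} {x : MvPolynomial (Fin mv) R}
    (hx : x ∈ FPV p R mv d N) (k : ℕ) : x ^ p ^ k ∈ FPV p R mv d (N + k) := by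
  induction k with
  | zero => simpa using hx
  | succ k ih =>
    have h1 : x ^ p ^ k ∈ FE p R mv d Set.univ (N + k) := by
      refine Submodule.span_mono ?_ ih
      rintro _ ⟨i, hi⟩
      exact ⟨i, trivial, hi⟩
    have := FE_le_FPV _ _ _ _ _ _ (FE_pow h1)
    rwa [← pow_mul, ← pow_succ] at this

/-- twisted powers of generators -/
def Gens (p : ℕ) (s : Finset (MvPolynomial (Fin mv) R)) (lv : MvPolynomial (Fin mv) R → ℕ)
    (N : ℕ) : Set (MvPolynomial (Fin mv) R) :=
  {g | ∃ f ∈ s, lv f ≤ N ∧ g = f ^ p ^ (N - lv f)}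

lemma Gens_FPV [Fact p.Prime] [CharP R p] {s : Finset (MvPolynomial (Fin mv) R)}
    {lv : MvPolynomial (Fin mv) R → ℕ} (hlv : ∀ f ∈ s, f ∈ FPV p R mv d (lv f)) {N : ℕ}
    {g : MvPolynomial (Fin mv) R} (hg : g ∈ Gens p s lv N) : g ∈ FPV p R mv d N := by
  obtain ⟨f, hf, hl, rfl⟩ := hg
  have := FPV_pow (hlv f hf) (N - lv f)
  rwa [Nat.add_sub_cancel' hl] at this

lemma Gens_I (hp : p.Prime) {s : Finset (MvPolynomial (Fin mv) R)}
    {lv : MvPolynomial (Fin mv) R → ℕ} {N : ℕ}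
    {g : MvPolynomial (Fin mv) R} (hg : g ∈ Gens p s lv N) :
    g ∈ Ideal.span (s : Set (MvPolynomial (Fin mv) R)) := by
  obtain ⟨f, hf, hl, rfl⟩ := hg
  exact Ideal.pow_mem_of_mem _ (Ideal.subset_span hf) _ (pow_pos hp.pos _)

lemma local_T [Fact p.Prime] [CharP R p] {s : Finset (MvPolynomial (Fin mv) R)}
    {lv : MvPolynomial (Fin mv) R → ℕ} (hlv : ∀ f ∈ s, f ∈ FPV p R mv d (lv f))
    (hflat : Module.Flat R (MvPolynomial (Fin mv) R ⧸ Ideal.span (s : Set (MvPolynomial (Fin mv) R))))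
    (T : Type*) [CommRing T] [Algebra R T] [IsLocalRing T] (N : ℕ) (f : MvPolynomial (Fin mv) T)
    (hf : f ∈ FPV p T mv d N) (hfI : f ∈ (Ideal.span (s : Set (MvPolynomial (Fin mv) R))).map
      (MvPolynomial.map (algebraMap R T))) :
    f ∈ Submodule.span T (MvPolynomial.map (algebraMap R T) '' Gens p s lv N) := by
  have hp : p.Prime := Fact.out
  have hc : CharP T p := by
    rw [CharP.charP_iff_prime_eq_zero hp, ← map_natCast (algebraMap R T), CharP.cast_eq_zero, map_zero]
  refine local_main (W := fun N => Submodule.span T (MvPolynomial.map (algebraMap R T) '' Gens p s lv N))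
    ?_ ?_ _ ?_ (flat_baseChange _ hflat) N f hf hfI
  · intro l
    refine Submodule.span_le.mpr ?_
    rintro _ ⟨g, hg, rfl⟩
    exact FPV_map _ (Gens_FPV hlv hg)
  · intro l w hw
    induction hw using Submodule.span_induction with
    | zero => rw [zero_pow hp.ne_zero]; exact zero_mem _
    | add x y _ _ hx hy => rw [add_pow_char]; exact add_mem hx hy
    | smul a x _ hx => rw [smul_pow]; exact Submodule.smul_mem _ _ hx
    | mem x hx =>
      obtain ⟨_, ⟨f, hf, hl, rfl⟩, rfl⟩ := hx
      refine Submodule.subset_span ⟨f ^ p ^ (l + 1 - lv f), ⟨f, hf, by omega, rfl⟩, ?_⟩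
      rw [← map_pow, ← pow_mul, ← pow_succ]
      congr 3; omega
  · apply le_antisymm
    · rw [Ideal.map_span, Ideal.span_le]
      rintro _ ⟨f, hf, rfl⟩
      refine Ideal.subset_span (Set.mem_iUnion.mpr ⟨lv f, Submodule.subset_span ⟨f, ⟨f, hf, le_rfl, ?_⟩, rfl⟩⟩)
      simp
    · rw [Ideal.span_le]
      refine Set.iUnion_subset fun l => ?_
      have : Submodule.span T (MvPolynomial.map (algebraMap R T) '' Gens p s lv l) ≤
          ((Ideal.span (s : Set (MvPolynomial (Fin mv) R))).map
            (MvPolynomial.map (algebraMap R T))).restrictScalars T := by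
        rw [Submodule.span_le]
        rintro _ ⟨g, hg, rfl⟩
        exact Ideal.mem_map_of_mem _ (Gens_I hp hg)
      exact this

end


/-- Let `I ⊆ R[𝔛]` be a twisted-linear ideal (generated by finitely many twisted-linear
elements) such that `R[𝔛]/I` is `R`-flat. Then for every `R`-algebra `S` and every `N`, the
`S`-span of the image of `FPV_N(R) ∩ I` in `S[𝔛]` equals `FPV_N(S) ∩ (I·S[𝔛])`:
cutting out the twisted-linear part of given degree is functorial w.r.t. base change. -/
theorem FPV_inter_baseChange
    (p : ℕ) (hp : p.Prime) (R : Type*) [CommRing R] [CharP R p]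
    (mv : ℕ) (d : Fin mv → ℕ) (I : Ideal (MvPolynomial (Fin mv) R))
    (htl : ∃ s : Finset (MvPolynomial (Fin mv) R),
      (∀ f ∈ s, ∃ l : ℕ, f ∈ FPV p R mv d l) ∧ I = Ideal.span s)
    (hflat : Module.Flat R (MvPolynomial (Fin mv) R ⧸ I))
    (S : Type*) [CommRing S] [Algebra R S] (N : ℕ) :
    Submodule.span S
        (MvPolynomial.map (algebraMap R S) ''
          ((FPV p R mv d N ⊓ I.restrictScalars R : Submodule R (MvPolynomial (Fin mv) R)) : Set (MvPolynomial (Fin mv) R)))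
      = FPV p S mv d N ⊓ (I.map (MvPolynomial.map (algebraMap R S))).restrictScalars S := by
  obtain ⟨s, hs, rfl⟩ := htl
  have := Fact.mk hp
  apply le_antisymm
  · rw [Submodule.span_le]
    rintro _ ⟨x, hx, rfl⟩
    exact ⟨FPV_map _ hx.1, Ideal.mem_map_of_mem _ hx.2⟩
  choose! lv hlv using hs
  rintro f ⟨hf, hfI⟩
  suffices h : f ∈ Submodule.span S (MvPolynomial.map (algebraMap R S) '' Gens p s lv N) by
    refine Submodule.span_mono (Set.image_mono ?_) h
    intro g hg
    exact ⟨Gens_FPV hlv hg, Gens_I hp hg⟩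
  have hloc : ∀ (P : Ideal S) [P.IsMaximal], IsLocalizedModule P.primeCompl
      (MvPolynomial.mapAlgHom (σ := Fin mv) (Algebra.ofId S (Localization.AtPrime P))).toLinearMap :=
    fun P _ => isLocMod P.primeCompl mv
  refine @Submodule.mem_of_localization_maximal S (MvPolynomial (Fin mv) S) _ _ _
    (fun P _ => MvPolynomial (Fin mv) (Localization.AtPrime P))
    (fun P _ => inferInstance) (fun P _ => inferInstance)
    (fun P _ => (MvPolynomial.mapAlgHom (σ := Fin mv)
      (Algebra.ofId S (Localization.AtPrime P))).toLinearMap) hloc f _ ?_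
  intro P hP
  rw [← Submodule.restrictScalars_localized' (Localization.AtPrime P), Submodule.restrictScalars_mem,
    Submodule.localized'_span]
  have key := local_T hlv hflat (Localization.AtPrime P) N
    (MvPolynomial.map (algebraMap S (Localization.AtPrime P)) f) (FPV_map _ hf) (by
      rw [Submodule.coe_restrictScalars] at hfI
      rw [IsScalarTower.algebraMap_eq R S (Localization.AtPrime P)]
      have h2 := Ideal.mem_map_of_mem (MvPolynomial.map (algebraMap S (Localization.AtPrime P))) hfI
      rw [Ideal.map_map] at h2
      convert h2 using 2
      ext <;> simp)
  convert key using 2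
  rw [Set.image_image]
  refine Set.image_congr fun g _ => ?_
  rw [IsScalarTower.algebraMap_eq R S (Localization.AtPrime P), ← MvPolynomial.map_map]
  rfl
  rfl
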